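/- arXiv:2604.25894 — 3 statements merged into one kernel-verified Lean document; each statement's English description precedes it below -/
import Mathlib

section
/- Let d ≥ 1 and let I₀ ⊆ {1,…,d} be a nonempty set with |I₀| = d₀. For each n ∈ ℕ let π_{n,1}, …, π_{n,d} be random variables with values in [0,1] and let α_n ∈ (0,1) with α_n → 0 as n → ∞. Assume: (i) for every k ∉ I₀ and every n, π_{n,k} is super-uniform; (ii) for every k ∈ I₀, P(π_{n,k} > (d₀/d)·(α_n/H_d)) → 0 as n → ∞, where H_d = ∑_{l=1}^d 1/l. Let Î_n be the Benjamini–Yekutieli step-up selected index set obtained from the p-values π_{n,1}, …, π_{n,d} at level α_n. Then P(Î_n = I₀) → 1 as n → ∞. -/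
open MeasureTheory Filter Topology Finset

/-- Harmonic number `H_d = ∑_{l=1}^d 1/l`. -/
noncomputable def harm (d : ℕ) : ℝ := ∑ l ∈ Finset.range d, (1 : ℝ) / (l + 1)

/-- Benjamini–Yekutieli threshold `τ_k = (k/d)·(α/H_d)`. -/
noncomputable def byThresh (d : ℕ) (α : ℝ) (k : ℕ) : ℝ := ((k : ℝ) / d) * (α / harm d)

/-- The step-up quantity `R = max {k ∈ {1,…,d} : p_{(k)} ≤ τ_k}` (and `R = 0` if no such `k`
exists), where `p_{(1)} ≤ ⋯ ≤ p_{(d)}` is the nondecreasing rearrangement of the p-values. -/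
noncomputable def byR {d : ℕ} (p : Fin d → ℝ) (α : ℝ) : ℕ :=
  (Finset.univ.filter fun k : Fin d =>
    (p ∘ Tuple.sort p) k ≤ byThresh d α (k.val + 1)).sup fun k => k.val + 1

/-- The Benjamini–Yekutieli selected index set `Î = {i : p_i ≤ τ_R}`. -/
noncomputable def bySelected {d : ℕ} (p : Fin d → ℝ) (α : ℝ) : Finset (Fin d) :=
  Finset.univ.filter fun i => p i ≤ byThresh d α (byR p α)

theorem one_le_harm {d : ℕ} (hd : 1 ≤ d) : 1 ≤ harm d := by
  have h := Finset.single_le_sum (f := fun l : ℕ => (1 : ℝ) / (l + 1))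
    (fun l _ => by positivity) (Finset.mem_range.2 hd)
  simpa [harm] using h

theorem byThresh_mono {d : ℕ} (hd : 1 ≤ d) {α : ℝ} (hα : 0 ≤ α) : Monotone (byThresh d α) := by
  intro j k hjk
  have := one_le_harm hd
  unfold byThresh
  gcongr

theorem byThresh_self {d : ℕ} (hd : 1 ≤ d) (α : ℝ) : byThresh d α d = α / harm d := by
  have : (d : ℝ) ≠ 0 := by positivity
  simp [byThresh, this]

theorem byR_le {d : ℕ} (p : Fin d → ℝ) (α : ℝ) : byR p α ≤ d :=
  Finset.sup_le fun k _ => k.isLt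

theorem le_byR {d : ℕ} (p : Fin d → ℝ) (α : ℝ) {m : ℕ}
    (hm : m ≤ #{i | p i ≤ byThresh d α m}) : m ≤ byR p α := by
  rcases m with _ | m
  · exact Nat.zero_le _
  have hmd : m < d :=
    (Nat.lt_of_succ_le hm).trans_le ((Finset.card_le_univ _).trans_eq (Fintype.card_fin d))
  have hcard : #{i | (p ∘ Tuple.sort p) i ≤ byThresh d α (m + 1)}
      = #{i | p i ≤ byThresh d α (m + 1)} :=
    Finset.card_equiv (Tuple.sort p) (by simp)
  have hle : (p ∘ Tuple.sort p) ⟨m, hmd⟩ ≤ byThresh d α (m + 1) := by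
    refine (Tuple.lt_card_le_iff_apply_le_of_monotone (Tuple.monotone_sort p)).1 ?_
    rw [hcard]
    exact hm
  exact Finset.le_sup (f := fun k : Fin d => k.val + 1) (b := ⟨m, hmd⟩) (by simpa using hle)

/-- The selection recovers `I` when the p-values in `I` lie below the threshold `τ_{|I|}` and
all others lie above the largest threshold `τ_d`. -/
theorem bySelected_eq {d : ℕ} (hd : 1 ≤ d) {α : ℝ} (hα : 0 ≤ α) (p : Fin d → ℝ)
    (I : Finset (Fin d)) (hI : ∀ k ∈ I, p k ≤ byThresh d α #I)
    (hIc : ∀ k ∉ I, byThresh d α d < p k) : bySelected p α = I := by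
  have hR : #I ≤ byR p α :=
    le_byR p α (Finset.card_le_card fun k hk => by simpa using hI k hk)
  ext k
  simp only [bySelected, Finset.mem_filter, Finset.mem_univ, true_and]
  refine ⟨fun hk => ?_, fun hk => (hI k hk).trans (byThresh_mono hd hα hR)⟩
  by_contra hkI
  exact (hk.trans (byThresh_mono hd hα (byR_le p α))).not_gt (hIc k hkI)

/-- Measurability of the events is not needed: subadditivity suffices. -/
theorem tendsto_measure_one_of_compl_le {Ω : ℕ → Type*} [∀ n, MeasurableSpace (Ω n)]
    (P : ∀ n, Measure (Ω n)) [∀ n, IsProbabilityMeasure (P n)] (A : ∀ n, Set (Ω n))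
    {b : ℕ → ENNReal} (hb : Tendsto b atTop (𝓝 0)) (hA : ∀ n, P n (A n)ᶜ ≤ b n) :
    Tendsto (fun n => P n (A n)) atTop (𝓝 1) := by
  have hlim : Tendsto (fun n => 1 - b n) atTop (𝓝 1) := by
    simpa using ENNReal.Tendsto.sub (tendsto_const_nhds (x := (1 : ENNReal))) hb (by simp)
  refine tendsto_of_tendsto_of_tendsto_of_le_of_le hlim tendsto_const_nhds (fun n => ?_)
    fun n => prob_le_one
  refine tsub_le_iff_right.2 ?_
  calc (1 : ENNReal) = P n (A n ∪ (A n)ᶜ) := by simp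
    _ ≤ P n (A n) + P n (A n)ᶜ := measure_union_le _ _
    _ ≤ P n (A n) + b n := by gcongr; exact hA n

/-- Consistency of Benjamini–Yekutieli step-up selection: if the p-values
outside `I₀` are super-uniform and the p-values in `I₀` fall below the threshold
`(d₀/d)·(α_n/H_d)` with probability tending to one, with levels `α_n → 0`, then the
BY-selected set equals `I₀` with probability tending to one. -/
theorem stmt0
    {d d₀ : ℕ} (hd : 1 ≤ d)
    (I₀ : Finset (Fin d)) (hne : I₀.Nonempty) (hcard : I₀.card = d₀)
    (Ω : ℕ → Type) [∀ n, MeasurableSpace (Ω n)]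
    (P : ∀ n, Measure (Ω n)) [∀ n, IsProbabilityMeasure (P n)]
    (π : ∀ n, Fin d → Ω n → ℝ)
    (hrange : ∀ n k ω, π n k ω ∈ Set.Icc (0 : ℝ) 1)
    (α : ℕ → ℝ) (hα : ∀ n, α n ∈ Set.Ioo (0 : ℝ) 1)
    (hα0 : Tendsto α atTop (𝓝 0))
    (hnull : ∀ n, ∀ k ∉ I₀, ∀ t ∈ Set.Icc (0 : ℝ) 1,
      P n {ω | π n k ω ≤ t} ≤ ENNReal.ofReal t)
    (halt : ∀ k ∈ I₀,
      Tendsto (fun n => P n {ω | byThresh d (α n) d₀ < π n k ω}) atTop (𝓝 0)) :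
    Tendsto (fun n => P n {ω | bySelected (fun i => π n i ω) (α n) = I₀})
      atTop (𝓝 1) := by
  subst hcard
  have hH := one_le_harm hd
  have hτ : Tendsto (fun n => ENNReal.ofReal (byThresh d (α n) d)) atTop (𝓝 0) := by
    simp only [byThresh_self hd]
    simpa using ENNReal.tendsto_ofReal (hα0.div_const (harm d))
  have hbound : Tendsto (fun n => ∑ k ∈ I₀, P n {ω | byThresh d (α n) #I₀ < π n k ω}
      + ∑ _k ∈ I₀ᶜ, ENNReal.ofReal (byThresh d (α n) d)) atTop (𝓝 0) := by
    simpa using (tendsto_finsetSum I₀ halt).add (tendsto_finsetSum I₀ᶜ fun _ _ => hτ)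
  refine tendsto_measure_one_of_compl_le P _ hbound fun n => ?_
  have hsub : {ω | bySelected (fun i => π n i ω) (α n) = I₀}ᶜ ⊆
      (⋃ k ∈ I₀, {ω | byThresh d (α n) #I₀ < π n k ω}) ∪
        ⋃ k ∈ I₀ᶜ, {ω | π n k ω ≤ byThresh d (α n) d} := by
    intro ω hω
    by_contra h
    simp only [Set.mem_union, Set.mem_iUnion, Set.mem_ofPred_eq, Finset.mem_compl, not_or,
      not_exists, not_lt, not_le] at h
    exact hω (bySelected_eq hd (hα n).1.le _ I₀ h.1 h.2)
  have hmem : byThresh d (α n) d ∈ Set.Icc (0 : ℝ) 1 := by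
    rw [byThresh_self hd]
    exact ⟨div_nonneg (hα n).1.le (by linarith),
      div_le_one_of_le₀ ((hα n).2.le.trans hH) (by linarith)⟩
  refine (measure_mono hsub).trans ((measure_union_le _ _).trans (add_le_add
    (measure_biUnion_finset_le _ _) ((measure_biUnion_finset_le _ _).trans
      (Finset.sum_le_sum fun k hk => hnull n k (Finset.mem_compl.1 hk) _ hmem))))
end

section
/- Let d ≥ 1 and let I₀ ⊆ {1,…,d} be a nonempty set. For each n ∈ ℕ let π_{n,1}, …, π_{n,d} be random variables with values in [0,1] and let α_n ∈ (0,1) with α_n → 0 as n → ∞. Assume: (i) for every k ∉ I₀ and every n, π_{n,k} is super-uniform; (ii) for every k ∈ I₀, P(π_{n,k} > α_n/d) → 0 as n → ∞. Define the Bonferroni selected set Î_n = {k ∈ {1,…,d} : π_{n,k} ≤ α_n/d}. Then P(Î_n = I₀) → 1 as n → ∞. -/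
open MeasureTheory Filter Topology Finset

/-- Consistency of Bonferroni selection: if the p-values outside `I₀` are
super-uniform and the p-values in `I₀` fall below `α_n/d` with probability tending to one,
with levels `α_n → 0`, then the Bonferroni selected set
`Î_n = {k : π_{n,k} ≤ α_n/d}` equals `I₀` with probability tending to one. -/
theorem stmt1
    {d : ℕ} (hd : 1 ≤ d)
    (I₀ : Finset (Fin d)) (hne : I₀.Nonempty)
    (Ω : ℕ → Type) [∀ n, MeasurableSpace (Ω n)]
    (P : ∀ n, Measure (Ω n)) [∀ n, IsProbabilityMeasure (P n)]
    (π : ∀ n, Fin d → Ω n → ℝ)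
    (hrange : ∀ n k ω, π n k ω ∈ Set.Icc (0 : ℝ) 1)
    (α : ℕ → ℝ) (hα : ∀ n, α n ∈ Set.Ioo (0 : ℝ) 1)
    (hα0 : Tendsto α atTop (𝓝 0))
    (hnull : ∀ n, ∀ k ∉ I₀, ∀ t ∈ Set.Icc (0 : ℝ) 1,
      P n {ω | π n k ω ≤ t} ≤ ENNReal.ofReal t)
    (halt : ∀ k ∈ I₀,
      Tendsto (fun n => P n {ω | α n / d < π n k ω}) atTop (𝓝 0)) :
    Tendsto (fun n => P n {ω | {k : Fin d | π n k ω ≤ α n / d} = (I₀ : Set (Fin d))})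
      atTop (𝓝 1) := by
  classical
  let E : ∀ n, Fin d → Set (Ω n) := fun n k =>
    if k ∈ I₀ then {ω | α n / d < π n k ω} else {ω | π n k ω ≤ α n / d}
  have hd' : (1 : ℝ) ≤ d := by exact_mod_cast hd
  have hlevel : ∀ n, α n / d ∈ Set.Icc (0 : ℝ) 1 := fun n =>
    ⟨div_nonneg (hα n).1.le (by linarith),
      (div_le_self (hα n).1.le hd').trans (hα n).2.le⟩
  have hE : ∀ k, Tendsto (fun n => P n (E n k)) atTop (𝓝 0) := by
    intro k
    by_cases hk : k ∈ I₀
    · simpa only [E, hk, if_true] using halt k hk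
    · have hlim : Tendsto (fun n => ENNReal.ofReal (α n / d)) atTop (𝓝 0) := by
        simpa using ENNReal.tendsto_ofReal (hα0.div_const (d : ℝ))
      refine tendsto_of_tendsto_of_tendsto_of_le_of_le tendsto_const_nhds hlim
        (fun n => zero_le) fun n => ?_
      simpa only [E, hk, if_false] using hnull n k hk _ (hlevel n)
  have hsum : Tendsto (fun n => ∑ k, P n (E n k)) atTop (𝓝 0) := by
    simpa using tendsto_finsetSum Finset.univ fun k _ => hE k
  have hlower : Tendsto (fun n => 1 - ∑ k, P n (E n k)) atTop (𝓝 1) := by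
    simpa using ENNReal.Tendsto.sub tendsto_const_nhds hsum (Or.inl ENNReal.one_ne_top)
  -- The events need not be measurable, so only subadditivity of `P n` is used.
  refine tendsto_of_tendsto_of_tendsto_of_le_of_le hlower tendsto_const_nhds
    (fun n => ?_) fun n => prob_le_one
  rw [tsub_le_iff_right, ← measure_univ (μ := P n)]
  have hcover : Set.univ ⊆
      {ω | {k : Fin d | π n k ω ≤ α n / d} = (I₀ : Set (Fin d))} ∪ ⋃ k, E n k := by
    intro ω _
    by_contra hω
    simp only [Set.mem_union, Set.mem_iUnion, not_or, not_exists] at hω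
    refine hω.1 (Set.ext fun k => ?_)
    have hk := hω.2 k
    by_cases hkI : k ∈ I₀ <;> simpa [E, hkI] using hk
  calc P n Set.univ ≤ P n (_ ∪ ⋃ k, E n k) := measure_mono hcover
    _ ≤ _ := (measure_union_le _ _).trans
      (add_le_add_right (measure_iUnion_fintype_le (P n) (E n)) _)
end

section
/- Let d ≥ 1 and let I₀ ⊆ {1,…,d}. For each n ∈ ℕ let π_{n,1}, …, π_{n,d} be random variables with values in [0,1]. Assume: (i) for every i ∉ I₀ and every ξ ∈ (0,1), limsup_{n→∞} P(π_{n,i} ≤ ξ) ≤ ξ; (ii) for every j ∈ I₀ and every ξ ∈ (0,1), P(π_{n,j} > ξ) → 0 as n → ∞. Let ℰ_n be the event {π_{n,j} < π_{n,i} for every j ∈ I₀ and every i ∉ I₀}, i.e., the event that every p-value indexed by I₀ is strictly smaller than every p-value indexed outside I₀. Then lim_{n→∞} P(ℰ_n) = 1. -/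
open MeasureTheory Filter Topology Finset

/-- If the p-values outside `I₀` are asymptotically super-uniform
(`limsup P(π_{n,i} ≤ ξ) ≤ ξ` for all `ξ ∈ (0,1)`) and the p-values in `I₀` tend to zero in
probability (`P(π_{n,j} > ξ) → 0` for all `ξ ∈ (0,1)`), then the probability of the event
`ℰ_n` that every p-value indexed by `I₀` is strictly smaller than every p-value indexed
outside `I₀` tends to one. -/
theorem stmt2
    {d : ℕ} (hd : 1 ≤ d)
    (I₀ : Finset (Fin d))
    (Ω : ℕ → Type) [∀ n, MeasurableSpace (Ω n)]
    (P : ∀ n, Measure (Ω n)) [∀ n, IsProbabilityMeasure (P n)]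
    (π : ∀ n, Fin d → Ω n → ℝ)
    (hrange : ∀ n k ω, π n k ω ∈ Set.Icc (0 : ℝ) 1)
    (hnull : ∀ i ∉ I₀, ∀ ξ ∈ Set.Ioo (0 : ℝ) 1,
      Filter.limsup (fun n => P n {ω | π n i ω ≤ ξ}) atTop ≤ ENNReal.ofReal ξ)
    (halt : ∀ j ∈ I₀, ∀ ξ ∈ Set.Ioo (0 : ℝ) 1,
      Tendsto (fun n => P n {ω | ξ < π n j ω}) atTop (𝓝 0)) :
    Tendsto (fun n => P n {ω | ∀ j ∈ I₀, ∀ i ∉ I₀, π n j ω < π n i ω})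
      atTop (𝓝 1) := by
  have hcompl : Tendsto
      (fun n => P n {ω | ∀ j ∈ I₀, ∀ i ∉ I₀, π n j ω < π n i ω}ᶜ) atTop (𝓝 0) := by
    rw [ENNReal.tendsto_nhds_zero]
    intro ε hε
    obtain ⟨ξ, hξε, hξ⟩ : ∃ ξ : ℝ, (d : ENNReal) * ENNReal.ofReal (2 * ξ) < ε ∧
        ξ ∈ Set.Ioo (0 : ℝ) 1 := by
      have hlim : Tendsto (fun ξ : ℝ => (d : ENNReal) * ENNReal.ofReal (2 * ξ))
          (𝓝[>] 0) (𝓝 0) := by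
        have h : Tendsto (fun ξ : ℝ => ENNReal.ofReal (2 * ξ)) (𝓝[>] 0) (𝓝 0) := by
          have hcont : Continuous fun ξ : ℝ => ENNReal.ofReal (2 * ξ) :=
            ENNReal.continuous_ofReal.comp (continuous_const_mul 2)
          simpa using (hcont.tendsto 0).mono_left nhdsWithin_le_nhds
        simpa using ENNReal.Tendsto.const_mul h (Or.inr (ENNReal.natCast_ne_top d))
      exact ((hlim.eventually_lt_const hε).and (Ioo_mem_nhdsGT one_pos)).exists
    have hlt : ENNReal.ofReal ξ < ENNReal.ofReal (2 * ξ) :=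
      (ENNReal.ofReal_lt_ofReal_iff (by linarith [hξ.1])).2 (by linarith [hξ.1])
    have hbad : ∀ k, ∀ᶠ n in atTop,
        P n {ω | (k ∈ I₀ → ξ < π n k ω) ∧ (k ∉ I₀ → π n k ω ≤ ξ)} ≤
          ENNReal.ofReal (2 * ξ) := by
      intro k
      by_cases hk : k ∈ I₀
      · simpa [hk] using ((halt k hk ξ hξ).eventually_lt_const
          ((zero_le).trans_lt hlt)).mono fun _ h => h.le
      · simpa [hk] using (eventually_lt_of_limsup_lt
          ((hnull k hk ξ hξ).trans_lt hlt)).mono fun _ h => h.le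
    filter_upwards [eventually_all.2 hbad] with n hn
    calc P n {ω | ∀ j ∈ I₀, ∀ i ∉ I₀, π n j ω < π n i ω}ᶜ
        ≤ P n (⋃ k, {ω | (k ∈ I₀ → ξ < π n k ω) ∧ (k ∉ I₀ → π n k ω ≤ ξ)}) := by
          refine measure_mono fun ω hω => ?_
          simp only [Set.mem_compl_iff, Set.mem_ofPred_eq, not_forall, not_lt] at hω
          obtain ⟨j, hj, i, hi, hij⟩ := hω
          rw [Set.mem_iUnion]
          by_cases h : ξ < π n j ω
          · exact ⟨j, fun _ => h, fun hj' => absurd hj hj'⟩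
          · exact ⟨i, fun hi' => absurd hi' hi, fun _ => hij.trans (not_lt.1 h)⟩
      _ ≤ ∑ k, P n {ω | (k ∈ I₀ → ξ < π n k ω) ∧ (k ∉ I₀ → π n k ω ≤ ξ)} :=
          measure_iUnion_fintype_le _ _
      _ ≤ ∑ _k : Fin d, ENNReal.ofReal (2 * ξ) := Finset.sum_le_sum fun k _ => hn k
      _ = d * ENNReal.ofReal (2 * ξ) := by simp
      _ ≤ ε := hξε.le
  have hlower := ENNReal.Tendsto.sub (tendsto_const_nhds (x := (1 : ENNReal))) hcompl
    (Or.inl ENNReal.one_ne_top)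
  rw [tsub_zero] at hlower
  refine tendsto_of_tendsto_of_tendsto_of_le_of_le hlower tendsto_const_nhds
    (fun n => ?_) fun n => prob_le_one
  rw [tsub_le_iff_right, ← measure_univ (μ := P n)]
  exact measure_univ_le_add_compl _
end
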